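/- Let n ≥ 2 be an integer, α > 0, p ∈ {1,…,n−1} coprime to n, and let g be a type (i) coupling satisfying the quantisation condition M ∈ ℤ ∖ {0}. Then for every r ∈ {1,…,n−1}, every ν ∈ S_n(ω_r), and every μ ∈ Λ⁺_{p,|M|} with μ+ν ∈ Λ⁺_{p,|M|} (note that −ν ∈ S_n(ω_{n−r})), one has W_ν(ρ_p+sgn(M)μ) = W_{−ν}(ρ_p+sgn(M)(μ+ν)), and this common value is a nonzero real number. -/

import Mathlib

noncomputable section
open Real Finset
open scoped Classical

/-- The standard basis vector `e_j` of `ℝⁿ` (1-based index), extended `n`-periodically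
(`e_{n+j} = e_j`). -/
def ee (n j : ℕ) : Fin n → ℝ := fun i => if ((i : ℕ) + 1) % n = j % n then 1 else 0

/-- The standard inner product on `ℝⁿ`. -/
def inn {n : ℕ} (x y : Fin n → ℝ) : ℝ := ∑ i, x i * y i

/-- The coordinate `x_j` (1-based index) with the convention `x_{n+k} = x_k - 2π/α`. -/
def coord {n : ℕ} (α : ℝ) (x : Fin n → ℝ) (j : ℕ) : ℝ :=
  if h : 0 < n then x ⟨(j - 1) % n, Nat.mod_lt _ h⟩ - 2 * π / α * (((j - 1) / n : ℕ) : ℝ)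
  else 0

/-- The simple roots `a_{j,p} = e_j - e_{j+p}`. -/
def aa (n p j : ℕ) : Fin n → ℝ := ee n j - ee n (j + p)

/-- The closed simplex `Σ̄_{g,p} = {x ∈ E_n : sgn(M)(x_j - x_{j+p} - g) ≥ 0, j = 1,…,n}`,
where `M = 2πp/α - ng`. -/
def SigmaBar (n p : ℕ) (α g : ℝ) : Set (Fin n → ℝ) :=
  {x | (∑ i, x i) = 0 ∧ ∀ j ∈ Icc 1 n,
    0 ≤ Real.sign (2 * π * p / α - n * g) * (coord α x j - coord α x (j + p) - g)}

/-- The interior `Σ_{g,p}` of the simplex, cut out by the strict inequalities. -/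
def SigmaInt (n p : ℕ) (α g : ℝ) : Set (Fin n → ℝ) :=
  {x | (∑ i, x i) = 0 ∧ ∀ j ∈ Icc 1 n,
    0 < Real.sign (2 * π * p / α - n * g) * (coord α x j - coord α x (j + p) - g)}

/-- `g` is a type (i) coupling, with `q ∈ {1,…,n-1}` the multiplicative inverse of `p` mod `n`. -/
def TypeI (n p q : ℕ) (α g : ℝ) : Prop :=
  1 ≤ q ∧ q ≤ n - 1 ∧ (p * q) % n = 1 % n ∧
  ((2 * π / α * ((p : ℝ) / n - 1 / ((n : ℝ) * q)) < g ∧ g < 2 * π / α * ((p : ℝ) / n)) ∨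
   (2 * π / α * ((p : ℝ) / n) < g ∧
      g < 2 * π / α * ((p : ℝ) / n + 1 / ((n : ℝ) * ((n : ℝ) - q)))))

/-- `ρ_p = g(ω_{1,p}+…+ω_{n-p,p}) + (g - 2π/α)(ω_{n-p+1,p}+…+ω_{n-1,p})`. -/
def rhoP (n p : ℕ) (α g : ℝ) (ω : ℕ → Fin n → ℝ) : Fin n → ℝ :=
  g • (∑ j ∈ Icc 1 (n - p), ω j) + (g - 2 * π / α) • (∑ j ∈ Icc (n - p + 1) (n - 1), ω j)

/-- `Λ⁺_{p,|M|}`: nonnegative integral combinations of the `ω_{j,p}` with coefficient sum `≤ |M|`. -/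
def Lam (n : ℕ) (Mabs : ℝ) (ω : ℕ → Fin n → ℝ) : Set (Fin n → ℝ) :=
  {μ | ∃ m : ℕ → ℕ, (∑ j ∈ Icc 1 (n - 1), (m j : ℝ)) ≤ Mabs ∧
    μ = ∑ j ∈ Icc 1 (n - 1), (m j : ℝ) • ω j}

/-- The fundamental weight `ω_r = e_1+…+e_r - (r/n)(e_1+…+e_n)`. -/
def omegaStd (n r : ℕ) : Fin n → ℝ :=
  fun i => (if (i : ℕ) + 1 ≤ r then 1 else 0) - (r : ℝ) / n

/-- Membership in the orbit `S_n(ω_r)` of `ω_r` under coordinate permutations. -/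
def inOrbit (n r : ℕ) (ν : Fin n → ℝ) : Prop :=
  ∃ σ : Equiv.Perm (Fin n), ν = fun i => omegaStd n r (σ i)

/-- The orbit `S_n(ω_r)` as a finite set. -/
def orbitF (n r : ℕ) : Finset (Fin n → ℝ) :=
  Finset.image (fun σ : Equiv.Perm (Fin n) => fun i => omegaStd n r (σ i)) Finset.univ

/-- `V_ν(g;x) = ∏_{a ∈ A_{n-1}, ⟨a,ν⟩=1} sin(α(⟨a,x⟩+g)/2)/sin(α⟨a,x⟩/2)`. -/
def Vnu (n : ℕ) (α g : ℝ) (ν x : Fin n → ℝ) : ℝ :=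
  ∏ j ∈ Icc 1 n, ∏ k ∈ Icc 1 n,
    if j ≠ k ∧ inn (ee n j - ee n k) ν = 1 then
      Real.sin (α * (inn (ee n j - ee n k) x + g) / 2) /
        Real.sin (α * inn (ee n j - ee n k) x / 2)
    else 1

/-- `V_J(g;x) = ∏_{j∈J, k∉J} sin(α(x_j-x_k+g)/2)/sin(α(x_j-x_k)/2)`. -/
def VJ (n : ℕ) (α g : ℝ) (J : Finset ℕ) (x : Fin n → ℝ) : ℝ :=
  ∏ j ∈ J, ∏ k ∈ Icc 1 n \ J,
    Real.sin (α * (coord α x j - coord α x k + g) / 2) /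
      Real.sin (α * (coord α x j - coord α x k) / 2)

/-- `F_J(g;x) = ∏_{j,k∈J, j≠k} sin(α(x_j-x_k)/2)/sin(α(x_j-x_k+g)/2)`. -/
def FJ (n : ℕ) (α g : ℝ) (J : Finset ℕ) (x : Fin n → ℝ) : ℝ :=
  ∏ j ∈ J, ∏ k ∈ J,
    if j ≠ k then
      Real.sin (α * (coord α x j - coord α x k) / 2) /
        Real.sin (α * (coord α x j - coord α x k + g) / 2)
    else 1

/-- The trigonometric Pochhammer symbol `(z : sin_α)_m`. -/
def poch (α z : ℝ) (m : ℤ) : ℝ :=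
  if 0 ≤ m then ∏ l ∈ Finset.range m.toNat, Real.sin (α * (z + l) / 2)
  else 1 / ∏ l ∈ Finset.Icc 1 (-m).toNat, Real.sin (α * (z - l) / 2)

/-- Membership in the set of positive roots `A⁺_{n-1,p}`. -/
def inPosRoots (n p : ℕ) (v : Fin n → ℝ) : Prop :=
  (∃ j ∈ Icc 1 n, ∃ k ∈ Icc 1 n, j ≠ k ∧ v = ee n j - ee n k) ∧
  ∃ c : ℕ → ℕ, v = ∑ j ∈ Icc 1 (n - 1), (c j : ℝ) • aa n p j

/-- The lattice function `Δ_p(μ)`. -/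
def Delta (n p : ℕ) (α g : ℝ) (ω : ℕ → Fin n → ℝ) (μ : Fin n → ℝ) : ℝ :=
  ∏ j ∈ Icc 1 n, ∏ k ∈ Icc 1 n,
    if inPosRoots n p (ee n j - ee n k) then
      Real.sin (α * inn (ee n j - ee n k)
          (rhoP n p α g ω + Real.sign (2 * π * p / α - n * g) • μ) / 2) /
        Real.sin (α * inn (ee n j - ee n k) (rhoP n p α g ω) / 2) *
      (poch α (inn (ee n j - ee n k) (rhoP n p α g ω) +
            Real.sign (2 * π * p / α - n * g) * g)
          ⌊Real.sign (2 * π * p / α - n * g) * inn (ee n j - ee n k) μ⌋ /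
        poch α (inn (ee n j - ee n k) (rhoP n p α g ω) + 1 -
            Real.sign (2 * π * p / α - n * g) * g)
          ⌊Real.sign (2 * π * p / α - n * g) * inn (ee n j - ee n k) μ⌋)
    else 1

/-- The coefficient `W_ν(ρ_p + sgn(M)μ)` (equal to `0` when `μ + ν ∉ Λ⁺_{p,|M|}`). -/
def Wmu (n p : ℕ) (α g : ℝ) (ω : ℕ → Fin n → ℝ) (s : (Fin n → ℝ) → ℝ)
    (μ ν : Fin n → ℝ) : ℝ :=
  if μ + ν ∈ Lam n |2 * π * p / α - n * g| ω then
    s ν * Real.sqrt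
      (Vnu n α g ν (rhoP n p α g ω + Real.sign (2 * π * p / α - n * g) • μ) *
       Vnu n α g ν (-(rhoP n p α g ω) - Real.sign (2 * π * p / α - n * g) • (μ + ν)))
  else 0

/-- The discrete difference operator `Ŝ_{r,M}` acting on lattice functions. -/
def SOp (n p r : ℕ) (α g : ℝ) (ω : ℕ → Fin n → ℝ) (s : (Fin n → ℝ) → ℝ)
    (φ : (Fin n → ℝ) → ℂ) : (Fin n → ℝ) → ℂ :=
  fun x => ∑ ν ∈ orbitF n r,
    (Wmu n p α g ω s (Real.sign (2 * π * p / α - n * g) • (x - rhoP n p α g ω)) ν : ℂ) *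
      φ (x + Real.sign (2 * π * p / α - n * g) • ν)

/-- The inner product `(φ, ψ)_{p,M}` on lattice functions. -/
def ip (n p : ℕ) (α g : ℝ) (ω : ℕ → Fin n → ℝ) (φ ψ : (Fin n → ℝ) → ℂ) : ℂ :=
  ∑ᶠ μ ∈ Lam n |2 * π * p / α - n * g| ω,
    φ (rhoP n p α g ω + Real.sign (2 * π * p / α - n * g) • μ) *
      starRingEnd ℂ (ψ (rhoP n p α g ω + Real.sign (2 * π * p / α - n * g) • μ))

/-- The elementary symmetric function `ℰ_r(u) = Σ_{ν ∈ S_n(ω_r)} exp(iα⟨ν,u⟩)`. -/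
def calE (n r : ℕ) (α : ℝ) (u : Fin n → ℝ) : ℂ :=
  ∑ ν ∈ orbitF n r, Complex.exp (Complex.I * (α : ℂ) * (inn ν u : ℂ))

/-- `x_j - x_{j+p} ≥ g` propagates along multiples of `p`. -/
lemma steps_nonneg {Y : ℕ → ℝ} {p : ℕ} {g σ : ℝ}
    (h : ∀ i, 0 ≤ σ * (Y i - Y (i + p) - g)) (t i : ℕ) :
    0 ≤ σ * (Y i - Y (i + p * t) - t * g) := by
  induction t with
  | zero => simp
  | succ t ih =>
    have h1 := h (i + p * t)
    rw [show i + p * (t + 1) = i + p * t + p by ring]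
    push_cast
    linarith

lemma sub_mul_period {Y : ℕ → ℝ} {n : ℕ} {T : ℝ} (hY : ∀ i, Y (i + n) = Y i - T) (i k : ℕ) :
    Y (i + k * n) = Y i - k * T := by
  induction k with
  | zero => simp
  | succ k ih =>
    rw [show i + (k + 1) * n = i + k * n + n by ring, hY, ih]
    push_cast
    ring

lemma gaps_of_ge {Y : ℕ → ℝ} {n p q k : ℕ} {g T : ℝ} (hp : 1 ≤ p) (hq : 1 ≤ q)
    (hpq : p * q = 1 + k * n) (hg : k * T < q * g) (hY : ∀ i, Y (i + n) = Y i - T)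
    (h : ∀ i, 0 ≤ (1 : ℝ) * (Y i - Y (i + p) - g)) :
    StrictAnti Y ∧ ∀ i m, m < p → Y i - Y (i + m) < g := by
  have hanti : StrictAnti Y := by
    refine strictAnti_nat_of_succ_lt fun i => ?_
    have h1 := steps_nonneg h q i
    rw [hpq, ← add_assoc, sub_mul_period hY] at h1
    linarith
  refine ⟨hanti, fun i m hm => ?_⟩
  have h1 := steps_nonneg h (q - 1) (i + (p - 1))
  have e : i + (p - 1) + p * (q - 1) = i + k * n := by
    obtain ⟨p, rfl⟩ := Nat.exists_eq_add_of_le hp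
    obtain ⟨q, rfl⟩ := Nat.exists_eq_add_of_le hq
    simp only [add_tsub_cancel_left]
    linarith
  rw [e, sub_mul_period hY, Nat.cast_sub hq] at h1
  have h2 := hanti.antitone (show i + m ≤ i + (p - 1) by omega)
  push_cast at h1
  linarith

lemma gaps_of_le {Y : ℕ → ℝ} {n p u l : ℕ} {g T : ℝ} (hu : 1 ≤ u)
    (hpu : 1 + p * u = l * n) (hg : u * g < l * T) (hY : ∀ i, Y (i + n) = Y i - T)
    (h : ∀ i, 0 ≤ (-1 : ℝ) * (Y i - Y (i + p) - g)) :
    StrictAnti Y ∧ ∀ i m, p < m → g < Y i - Y (i + m) := by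
  have hanti : StrictAnti Y := by
    refine strictAnti_nat_of_succ_lt fun i => ?_
    have h1 := steps_nonneg h u (i + 1)
    rw [add_assoc, hpu, sub_mul_period hY] at h1
    linarith
  refine ⟨hanti, fun i m hm => ?_⟩
  have h1 := steps_nonneg h (u - 1) (i + (p + 1))
  have e : i + (p + 1) + p * (u - 1) = i + l * n := by
    obtain ⟨u, rfl⟩ := Nat.exists_eq_add_of_le hu
    simp only [add_tsub_cancel_left]
    linarith
  rw [e, sub_mul_period hY, Nat.cast_sub hu] at h1
  have h2 := hanti.antitone (show i + (p + 1) ≤ i + m by omega)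
  push_cast at h1
  linarith

/-- For a type (i) coupling, whether the gap `x_j - x_{j+m}` exceeds `g` depends only on `m`. -/
lemma TypeI.exists_threshold {n p q : ℕ} {α g : ℝ} (hn : 2 ≤ n) (hα : 0 < α) (hp1 : 1 ≤ p)
    (hpn : p ≤ n - 1) (h : TypeI n p q α g) :
    0 < g ∧ g < 2 * π / α ∧ ∃ c : ℕ, ∀ Y : ℕ → ℝ, (∀ i, Y (i + n) = Y i - 2 * π / α) →
      (∀ i, 0 ≤ Real.sign (2 * π * p / α - n * g) * (Y i - Y (i + p) - g)) →
      StrictAnti Y ∧ ∀ i m,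
        (m = p → 0 < Real.sign (2 * π * p / α - n * g) * (Y i - Y (i + p) - g)) →
        (c ≤ m → g < Y i - Y (i + m)) ∧ (m < c → Y i - Y (i + m) < g) := by
  obtain ⟨hq1, hqn, hpq, h⟩ := h
  have hT : 0 < 2 * π / α := by positivity
  have e : 2 * π * p / α = 2 * π / α * p := by ring
  rw [e]
  generalize 2 * π / α = T at *
  have hn0 : (0 : ℝ) < n := by exact_mod_cast (by omega : 0 < n)
  have hq0 : (0 : ℝ) < q := by exact_mod_cast hq1
  have hpn' : (p : ℝ) + 1 ≤ n := by exact_mod_cast (by omega : p + 1 ≤ n)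
  have hk : p * q = 1 + (p * q / n) * n := by
    have := Nat.div_add_mod (p * q) n
    rw [hpq, Nat.mod_eq_of_lt (by omega : 1 < n)] at this
    linarith
  set k := p * q / n
  have hkR : (p : ℝ) * q = 1 + k * n := by exact_mod_cast hk
  rcases h with ⟨h1, h2⟩ | ⟨h1, h2⟩
  · have h1' : k * T < q * g := by
      have : T * ((p : ℝ) / n - 1 / (n * q)) = k * T / q := by
        field_simp
        linear_combination hkR
      rw [this, div_lt_iff₀ hq0] at h1
      linarith
    have h2' : n * g < T * p := by
      rw [← mul_div_assoc, lt_div_iff₀ hn0] at h2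
      linarith
    have hg0 : 0 < g := by
      have : 0 ≤ k * T := by positivity
      exact pos_of_mul_pos_right (this.trans_lt h1') hq0.le
    refine ⟨hg0, ?_, p, fun Y hY hσ => ?_⟩
    · have : n * g < n * T := by nlinarith
      exact lt_of_mul_lt_mul_left this hn0.le
    rw [Real.sign_of_pos (by linarith)] at hσ ⊢
    obtain ⟨ha, hb⟩ := gaps_of_ge hp1 hq1 hk h1' hY hσ
    refine ⟨ha, fun i m hm => ⟨fun hc => ?_, hb i m⟩⟩
    rcases hc.eq_or_lt with rfl | hc
    · linarith [hm rfl]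
    · linarith [hσ i, ha (show i + p < i + m by omega)]
  · have hu0 : (0 : ℝ) < (n : ℝ) - q := by
      have : (q : ℝ) + 1 ≤ n := by exact_mod_cast (by omega : q + 1 ≤ n)
      linarith
    have hkp : k ≤ p := by
      refine Nat.div_le_of_le_mul ?_
      rw [mul_comm n]
      exact Nat.mul_le_mul_left p (by omega)
    have hpu : 1 + p * (n - q) = (p - k) * n := by
      zify [hkp, (by omega : q ≤ n)]
      zify at hk
      linear_combination -hk
    have h1' : T * p < n * g := by
      rw [← mul_div_assoc, div_lt_iff₀ hn0] at h1
      linarith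
    have h2' : ((n - q : ℕ) : ℝ) * g < ((p - k : ℕ) : ℝ) * T := by
      rw [Nat.cast_sub (by omega), Nat.cast_sub hkp]
      have : T * ((p : ℝ) / n + 1 / (n * ((n : ℝ) - q))) = (p - k) * T / (n - q) := by
        field_simp
        linear_combination -hkR
      rw [this, lt_div_iff₀ hu0] at h2
      linarith
    refine ⟨?_, ?_, p + 1, fun Y hY hσ => ?_⟩
    · exact pos_of_mul_pos_right ((by positivity : 0 ≤ T * p).trans_lt h1') hn0.le
    · refine h2.trans_le ?_
      have hu1 : (1 : ℝ) ≤ (n : ℝ) - q := by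
        have : (q : ℝ) + 1 ≤ n := by exact_mod_cast (by omega : q + 1 ≤ n)
        linarith
      have : (p : ℝ) / n + 1 / (n * ((n : ℝ) - q)) ≤ 1 := by
        have : 1 / (n * ((n : ℝ) - q)) ≤ 1 / n :=
          one_div_le_one_div_of_le hn0 (le_mul_of_one_le_right hn0.le hu1)
        refine (add_le_add_right this _).trans ?_
        rw [← add_div, div_le_one hn0]
        exact hpn'
      nlinarith
    rw [Real.sign_of_neg (by linarith)] at hσ ⊢
    obtain ⟨ha, hb⟩ := gaps_of_le (by omega) hpu h2' hY hσ
    refine ⟨ha, fun i m hm => ⟨hb i m, fun hc => ?_⟩⟩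
    rcases (Nat.le_of_lt_succ hc).eq_or_lt with rfl | hc
    · linarith [hm rfl]
    · linarith [hσ i, ha (show i + m < i + p by omega)]

lemma sin_div_sin_shift {α g d : ℝ} (hα : 0 < α) :
    Real.sin (α * (2 * π / α - d + g) / 2) / Real.sin (α * (2 * π / α - d) / 2) =
      Real.sin (α * (d - g) / 2) / Real.sin (α * d / 2) := by
  rw [show α * (2 * π / α - d + g) / 2 = π - α * (d - g) / 2 by field_simp; ring,
    show α * (2 * π / α - d) / 2 = π - α * d / 2 by field_simp, Real.sin_pi_sub, Real.sin_pi_sub]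

lemma sin_div_sin_neg {α g d : ℝ} :
    Real.sin (α * (-d + g) / 2) / Real.sin (α * (-d) / 2) =
      Real.sin (α * (d - g) / 2) / Real.sin (α * d / 2) := by
  rw [show α * (-d + g) / 2 = -(α * (d - g) / 2) by ring,
    show α * (-d) / 2 = -(α * d / 2) by ring, Real.sin_neg, Real.sin_neg, neg_div_neg_eq]

lemma sin_half_pos {α d : ℝ} (hα : 0 < α) (h0 : 0 < d) (h1 : d < 2 * π / α) :
    0 < Real.sin (α * d / 2) := by
  rw [lt_div_iff₀ hα] at h1
  exact Real.sin_pos_of_pos_of_lt_pi (by positivity) (by linarith)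

lemma coord_add_period {n : ℕ} {α : ℝ} (hn : 0 < n) (x : Fin n → ℝ) (i : ℕ) :
    coord α x (i + n + 1) = coord α x (i + 1) - 2 * π / α := by
  simp only [coord, hn, dif_pos, add_tsub_cancel_right, Nat.add_mod_right,
    Nat.add_div_right i hn]
  push_cast
  ring

lemma coord_fin {n : ℕ} {α : ℝ} (x : Fin n → ℝ) (i : Fin n) : coord α x (i + 1) = x i := by
  have hn : 0 < n := i.pos
  simp [coord, hn, Nat.mod_eq_of_lt i.2, Nat.div_eq_of_lt i.2]

lemma coord_periodic_gap {n p : ℕ} {α : ℝ} (hn : 0 < n) (x : Fin n → ℝ) (i : ℕ) :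
    coord α x (i + 1) - coord α x (i + p + 1) =
      coord α x (i % n + 1) - coord α x (i % n + p + 1) := by
  have key := fun j => sub_mul_period (Y := fun i => coord α x (i + 1)) (coord_add_period hn x) j
    (i / n)
  have e := Nat.mod_add_div' i n
  have h1 := key (i % n)
  have h2 := key (i % n + p)
  rw [e] at h1
  rw [show i % n + p + i / n * n = i + p by omega] at h2
  linarith

/-- The sign of a factor of `V_ν` on the closed simplex, away from the vanishing wall. -/
lemma TypeI.exists_sign {n p q : ℕ} [NeZero n] {α g : ℝ} (hn : 2 ≤ n) (hα : 0 < α)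
    (hp1 : 1 ≤ p) (hpn : p ≤ n - 1) (h : TypeI n p q α g) :
    ∃ f : Fin n → ℝ, (∀ d, f d * f d = 1) ∧ ∀ x ∈ SigmaBar n p α g, ∀ i l : Fin n, i ≠ l →
      ((i - l).val = p → 0 < Real.sign (2 * π * p / α - n * g) *
        (coord α x (l + 1) - coord α x (l + 1 + p) - g)) →
      0 < Real.sin (α * (x i - x l + g) / 2) / Real.sin (α * (x i - x l) / 2) * f (i - l) := by
  obtain ⟨hg0, hgT, c, hc⟩ := h.exists_threshold hn hα hp1 hpn
  refine ⟨fun d => if c ≤ d.val then 1 else -1, fun d => by dsimp only; split_ifs <;> norm_num,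
    fun x hx i l hil hw => ?_⟩
  have hn0 : 0 < n := by omega
  obtain ⟨ha, hb⟩ := hc (fun i => coord α x (i + 1)) (coord_add_period hn0 x) fun j => by
    have := hx.2 (j % n + 1) (by simpa using Nat.succ_le_of_lt (Nat.mod_lt j hn0))
    rwa [add_right_comm (j % n), ← coord_periodic_gap hn0] at this
  set m := (i - l).val with hm
  have hmn : m < n := (i - l).2
  have hm0 : 0 < m := by
    rw [hm, Nat.pos_iff_ne_zero]
    intro h0
    exact hil (sub_eq_zero.1 (Fin.ext (by simpa using h0)))
  have hlm : (l.val + m = i.val) ∨ (l.val + m = i.val + n) := by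
    have := i.2
    have := l.2
    rw [hm, Fin.sub_def]
    simp only
    rcases le_or_gt l.val i.val with hle | hlt
    · left
      rw [show n - l.val + i.val = i.val - l.val + n by omega, Nat.add_mod_right,
        Nat.mod_eq_of_lt (by omega)]
      omega
    · right
      rw [Nat.mod_eq_of_lt (by omega)]
      omega
  obtain ⟨hb1, hb2⟩ := hb l.val m fun h => by
    have := hw h
    rwa [add_right_comm (l : ℕ)] at this
  set d := coord α x (l.val + 1) - coord α x (l.val + m + 1) with hd
  have hd0 : 0 < d := sub_pos.2 (ha (show l.val < l.val + m by omega))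
  have hdT : d < 2 * π / α := by
    have h1 := ha (show l.val + m < l.val + n by omega)
    have h2 := coord_add_period (α := α) hn0 x l.val
    simp only at h1
    linarith
  have hF : Real.sin (α * (x i - x l + g) / 2) / Real.sin (α * (x i - x l) / 2) =
      Real.sin (α * (d - g) / 2) / Real.sin (α * d / 2) := by
    rcases hlm with e | e
    · rw [e, coord_fin, coord_fin] at hd
      rw [show x i - x l = -d by linarith, sin_div_sin_neg]
    · rw [e, coord_add_period hn0, coord_fin, coord_fin] at hd
      rw [show x i - x l = 2 * π / α - d by linarith, sin_div_sin_shift hα]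
  have hs := sin_half_pos hα hd0 hdT
  rw [hF]
  dsimp only
  rw [← hm]
  split_ifs with hcm
  · have := hb1 hcm
    have := sin_half_pos hα (show 0 < d - g by linarith) (by linarith)
    positivity
  · have := hb2 (not_le.1 hcm)
    have := sin_half_pos hα (show 0 < g - d by linarith) (by linarith)
    rw [show α * (d - g) / 2 = -(α * (g - d) / 2) by ring, Real.sin_neg, neg_div, mul_neg_one,
      neg_neg]
    positivity

lemma inn_ee_sub {n : ℕ} (i l : Fin n) (x : Fin n → ℝ) :
    inn (ee n (i + 1) - ee n (l + 1)) x = x i - x l := by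
  have key (k : Fin n) : ∑ j, ee n (k + 1) j * x j = x k := by
    have : ∀ j : Fin n, ee n (k + 1) j = if j = k then 1 else 0 := fun j => by
      have : ((j : ℕ) + 1) % n = ((k : ℕ) + 1) % n ↔ j = k := by
        constructor
        · intro h
          have h' : (j : ℕ) ≡ k [MOD n] := Nat.ModEq.add_right_cancel' 1 h
          exact Fin.ext (Nat.ModEq.eq_of_lt_of_lt h' j.2 k.2)
        · rintro rfl
          rfl
      simp only [ee, this]
    simp [this]
  simp only [inn, Pi.sub_apply, sub_mul, Finset.sum_sub_distrib, key]

lemma prod_Icc_one_eq_fin {n : ℕ} (f : ℕ → ℝ) : ∏ j ∈ Icc 1 n, f j = ∏ i : Fin n, f (i + 1) := by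
  rw [Fin.prod_univ_eq_prod_range (fun i => f (i + 1)), ← Finset.Ico_add_one_right_eq_Icc,
    Finset.prod_Ico_eq_prod_range]
  simp [add_comm]

lemma sum_Icc_one_eq_fin {n : ℕ} (f : ℕ → ℝ) : ∑ j ∈ Icc 1 n, f j = ∑ i : Fin n, f (i + 1) := by
  rw [Fin.sum_univ_eq_sum_range (fun i => f (i + 1)), ← Finset.Ico_add_one_right_eq_Icc,
    Finset.sum_Ico_eq_sum_range]
  simp [add_comm]

lemma Vnu_eq_prod_fin {n : ℕ} (α g : ℝ) (ν x : Fin n → ℝ) :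
    Vnu n α g ν x = ∏ i, ∏ l, if ν i - ν l = 1 then
      Real.sin (α * (x i - x l + g) / 2) / Real.sin (α * (x i - x l) / 2) else 1 := by
  rw [Vnu, prod_Icc_one_eq_fin]
  refine Finset.prod_congr rfl fun i _ => ?_
  rw [prod_Icc_one_eq_fin]
  refine Finset.prod_congr rfl fun l _ => ?_
  simp only [inn_ee_sub]
  refine if_congr ⟨And.right, fun h => ⟨?_, h⟩⟩ rfl rfl
  intro hil
  have : i = l := Fin.ext (by omega)
  simp [this] at h

lemma Vnu_neg_neg {n : ℕ} (α g : ℝ) (ν x : Fin n → ℝ) :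
    Vnu n α g (-ν) (-x) = Vnu n α g ν x := by
  rw [Vnu_eq_prod_fin, Vnu_eq_prod_fin, Finset.prod_comm]
  simp only [Pi.neg_apply, neg_sub_neg]

lemma inOrbit.exists_sub_eq_one_iff {n r : ℕ} {ν : Fin n → ℝ} (h : inOrbit n r ν) :
    ∃ J : Finset (Fin n), ∀ i l, ν i - ν l = 1 ↔ i ∈ J ∧ l ∉ J := by
  obtain ⟨σ, rfl⟩ := h
  refine ⟨Finset.univ.filter fun i => (σ i : ℕ) + 1 ≤ r, fun i l => ?_⟩
  simp only [omegaStd, Finset.mem_filter, Finset.mem_univ, true_and]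
  split_ifs with h1 h2 h2
  · simp [h1, h2]
  · simp [h1, h2]
  · simp only [h1, false_and, iff_false]
    intro h
    linarith
  · simp [h1]

lemma inOrbit.neg {n r : ℕ} {ν : Fin n → ℝ} (hn : 0 < n) (hr : r ≤ n) (h : inOrbit n r ν) :
    inOrbit n (n - r) (-ν) := by
  obtain ⟨σ, rfl⟩ := h
  refine ⟨σ.trans Fin.revPerm, funext fun i => ?_⟩
  have hn0 : (n : ℝ) ≠ 0 := by exact_mod_cast hn.ne'
  have hi := (σ i).2
  simp only [omegaStd, Pi.neg_apply, Equiv.trans_apply, Fin.revPerm_apply, Fin.val_rev,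
    Nat.cast_sub hr, sub_div, div_self hn0]
  split_ifs <;> first | omega | ring

/-- The numbers of ordered pairs in `J × Jᶜ` with difference `d` and with difference `-d` agree. -/
lemma prod_sign_eq_one {n : ℕ} [NeZero n] (f : Fin n → ℝ) (hf : ∀ d, f d * f d = 1)
    (J : Finset (Fin n)) :
    ∏ i ∈ J, ∏ l ∈ Jᶜ, f (i - l) * f (l - i) = 1 := by
  have h1 : ∏ i ∈ J, ∏ l, f (i - l) * f (l - i) = 1 := by
    refine Finset.prod_eq_one fun i _ => ?_
    have e1 : ∏ l, f (i - l) = ∏ d, f d := Equiv.prod_comp (Equiv.subLeft i) f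
    have e2 : ∏ l, f (l - i) = ∏ d, f d := Equiv.prod_comp (Equiv.subRight i) f
    rw [Finset.prod_mul_distrib, e1, e2, ← Finset.prod_mul_distrib]
    exact Finset.prod_eq_one fun d _ => hf d
  have h2 : ∏ i ∈ J, ∏ l ∈ J, f (i - l) * f (l - i) = 1 := by
    simp only [Finset.prod_mul_distrib]
    rw [Finset.prod_comm (f := fun i l => f (l - i)), ← Finset.prod_mul_distrib]
    refine Finset.prod_eq_one fun i _ => ?_
    rw [← Finset.prod_mul_distrib]
    exact Finset.prod_eq_one fun d _ => hf _
  have h3 : ∀ i, ∏ l, f (i - l) * f (l - i) =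
      (∏ l ∈ J, f (i - l) * f (l - i)) * ∏ l ∈ Jᶜ, f (i - l) * f (l - i) := fun i =>
    (Finset.prod_mul_prod_compl J _).symm
  simp only [h3, Finset.prod_mul_distrib (s := J)] at h1
  have h4 := h2
  simp only [Finset.prod_mul_distrib (s := J)] at h4
  rw [h4, one_mul] at h1
  exact h1

/-- Positivity of `V_ν(g;x) V_ν(g;-y)` when the relevant walls are avoided. -/
lemma Vnu_mul_Vnu_neg_pos {n p q r : ℕ} {α g : ℝ} (hn : 2 ≤ n) (hα : 0 < α)
    (hp1 : 1 ≤ p) (hpn : p ≤ n - 1) (h : TypeI n p q α g) {ν x y : Fin n → ℝ}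
    (hν : inOrbit n r ν) (hx : x ∈ SigmaBar n p α g) (hy : y ∈ SigmaBar n p α g)
    (hwx : ∀ i l : Fin n, ν i - ν l = 1 → i.val = (l.val + p) % n →
      0 < Real.sign (2 * π * p / α - n * g) *
        (coord α x (l + 1) - coord α x (l + 1 + p) - g))
    (hwy : ∀ i l : Fin n, ν i - ν l = 1 → l.val = (i.val + p) % n →
      0 < Real.sign (2 * π * p / α - n * g) *
        (coord α y (i + 1) - coord α y (i + 1 + p) - g)) :
    0 < Vnu n α g ν x * Vnu n α g ν (-y) := by
  have : NeZero n := ⟨by omega⟩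
  obtain ⟨f, hf, hsign⟩ := h.exists_sign hn hα hp1 hpn
  obtain ⟨J, hJ⟩ := hν.exists_sub_eq_one_iff
  have hval : ∀ i l : Fin n, (i - l).val = p → i.val = (l.val + p) % n := by
    intro i l hil
    rw [← hil, ← Fin.val_add, add_sub_cancel]
  have hV : ∀ z, Vnu n α g ν z = ∏ i ∈ J, ∏ l ∈ Jᶜ,
      Real.sin (α * (z i - z l + g) / 2) / Real.sin (α * (z i - z l) / 2) := by
    intro z
    rw [Vnu_eq_prod_fin, ← Finset.prod_subset (Finset.subset_univ J)]
    · refine Finset.prod_congr rfl fun i hi => ?_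
      rw [← Finset.prod_subset (Finset.subset_univ Jᶜ)]
      · exact Finset.prod_congr rfl fun l hl => if_pos ((hJ i l).2 ⟨hi, Finset.mem_compl.1 hl⟩)
      · intro l _ hl
        exact if_neg fun hc => hl (Finset.mem_compl.2 ((hJ i l).1 hc).2)
    · intro i _ hi
      exact Finset.prod_eq_one fun l _ => if_neg fun hc => hi ((hJ i l).1 hc).1
  rw [← mul_one (Vnu n α g ν x * _), ← prod_sign_eq_one f hf J, hV, hV]
  simp only [← Finset.prod_mul_distrib]
  refine Finset.prod_pos fun i hi => Finset.prod_pos fun l hl => ?_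
  have hl' := Finset.mem_compl.1 hl
  have hil : i ≠ l := fun e => hl' (e ▸ hi)
  have hν1 := (hJ i l).2 ⟨hi, hl'⟩
  have h1 := hsign x hx i l hil fun e => hwx i l hν1 (hval i l e)
  have h2 := hsign y hy l i hil.symm fun e => hwy i l hν1 (hval l i e)
  simp only [Pi.neg_apply, neg_sub_neg]
  convert mul_pos h1 h2 using 1
  ring

lemma coord_add_p {n p : ℕ} {α : ℝ} (hp : p ≤ n) (x : Fin n → ℝ) {i l : Fin n}
    (h : i.val = (l.val + p) % n) :
    coord α x (l + 1 + p) = x i - 2 * π / α * (if n ≤ l + p then 1 else 0) := by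
  have hn : 0 < n := i.pos
  have hl := l.2
  have hd : (l.val + p) / n = if n ≤ l + p then 1 else 0 := by
    split_ifs with hc
    · exact Nat.div_eq_of_lt_le (by omega) (by omega)
    · exact Nat.div_eq_of_lt (by omega)
  simp only [coord, hn, dif_pos, add_right_comm l.val 1 p, add_tsub_cancel_right, hd, ← h]
  push_cast
  rfl

lemma coord_add {n : ℕ} {α c : ℝ} (x ν : Fin n → ℝ) {p : ℕ} (hp : p ≤ n) {i l : Fin n}
    (h : i.val = (l.val + p) % n) :
    coord α (x + c • ν) (l + 1) - coord α (x + c • ν) (l + 1 + p) =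
      coord α x (l + 1) - coord α x (l + 1 + p) - c * (ν i - ν l) := by
  rw [coord_add_p hp _ h, coord_add_p hp _ h, coord_fin, coord_fin]
  simp only [Pi.add_apply, Pi.smul_apply, smul_eq_mul]
  ring

lemma sum_coord_gap {n : ℕ} {α : ℝ} (hn : 0 < n) (x : Fin n → ℝ) (p : ℕ) :
    ∑ j ∈ Icc 1 n, (coord α x j - coord α x (j + p)) = p * (2 * π / α) := by
  have key : ∀ m : ℕ, ∑ i ∈ Finset.range n, coord α x (i + m + 1) =
      ∑ i ∈ Finset.range n, coord α x (i + 1) - m * (2 * π / α) := by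
    intro m
    induction m with
    | zero => simp
    | succ m ih =>
      have h1 := Finset.sum_range_succ (fun i => coord α x (i + m + 1)) n
      have h2 := Finset.sum_range_succ' (fun i => coord α x (i + m + 1)) n
      have h3 := coord_add_period (α := α) hn x m
      simp only [zero_add] at h2
      simp only [add_comm n m, h3] at h1
      simp only [add_right_comm _ 1 m] at h2
      simp only [← add_assoc]
      push_cast
      linarith
  rw [sum_Icc_one_eq_fin,
    Fin.sum_univ_eq_sum_range (fun i => coord α x (i + 1) - coord α x (i + 1 + p)),
    Finset.sum_sub_distrib]
  simp only [add_right_comm _ 1 p, key]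
  ring

lemma inn_aa {n p : ℕ} (x : Fin n → ℝ) {i l : Fin n} (h : i.val = (l.val + p) % n) :
    inn (aa n p (l + 1)) x = x l - x i := by
  have : ee n (l + 1 + p) = ee n (i + 1) := by
    funext k
    simp only [ee, h, Nat.mod_add_mod, add_right_comm]
  rw [aa, this, inn_ee_sub]

lemma inn_add {n : ℕ} (a x y : Fin n → ℝ) : inn a (x + y) = inn a x + inn a y := by
  simp [inn, mul_add, Finset.sum_add_distrib]

lemma inn_smul {n : ℕ} (a : Fin n → ℝ) (c : ℝ) (x : Fin n → ℝ) :
    inn a (c • x) = c * inn a x := by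
  simp only [inn, Pi.smul_apply, smul_eq_mul, Finset.mul_sum]
  exact Finset.sum_congr rfl fun _ _ => by ring

lemma inn_sum {n : ℕ} (a : Fin n → ℝ) (s : Finset ℕ) (f : ℕ → Fin n → ℝ) :
    inn a (∑ k ∈ s, f k) = ∑ k ∈ s, inn a (f k) := by
  simp only [inn, Finset.sum_apply, Finset.mul_sum]
  exact Finset.sum_comm

lemma rhoP_add_mem_SigmaBar {n p : ℕ} {α g : ℝ} (hn : 2 ≤ n) (hp1 : 1 ≤ p) (hpn : p ≤ n - 1)
    (hM : 2 * π * p / α - n * g ≠ 0) {ω : ℕ → Fin n → ℝ}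
    (hωE : ∀ k : ℕ, 1 ≤ k → k ≤ n - 1 → ∑ i, ω k i = 0)
    (hωδ : ∀ j : ℕ, 1 ≤ j → j ≤ n - 1 → ∀ k : ℕ, 1 ≤ k → k ≤ n - 1 →
      inn (aa n p j) (ω k) = if j = k then (1 : ℝ) else 0)
    {μ : Fin n → ℝ} (hμ : μ ∈ Lam n |2 * π * p / α - n * g| ω) :
    rhoP n p α g ω + Real.sign (2 * π * p / α - n * g) • μ ∈ SigmaBar n p α g := by
  obtain ⟨m, hm, rfl⟩ := hμ
  set M := 2 * π * p / α - n * g with hMdef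
  set x := rhoP n p α g ω + Real.sign M • ∑ j ∈ Icc 1 (n - 1), (m j : ℝ) • ω j with hx
  have hσ : Real.sign M * Real.sign M = 1 := by
    rcases Real.sign_apply_eq_of_ne_zero M hM with h | h <;> rw [h] <;> norm_num
  have hσM : Real.sign M * M = |M| := by
    rcases hM.lt_or_gt with h | h
    · rw [Real.sign_of_neg h, abs_of_neg h]; ring
    · rw [Real.sign_of_pos h, abs_of_pos h]; ring
  have hgap : ∀ j ∈ Icc 1 (n - 1),
      Real.sign M * (coord α x j - coord α x (j + p) - g) = m j := by
    intro j hj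
    have hj' := Finset.mem_Icc.1 hj
    obtain ⟨l, rfl⟩ : ∃ l : Fin n, j = l + 1 := ⟨⟨j - 1, by omega⟩, by simp; omega⟩
    obtain ⟨i, hi⟩ : ∃ i : Fin n, i.val = (l.val + p) % n :=
      ⟨⟨(l.val + p) % n, Nat.mod_lt _ (by omega)⟩, rfl⟩
    have hin : inn (aa n p (l + 1)) x =
        g + (if n ≤ l + p then -(2 * π / α) else 0) + Real.sign M * m (l + 1) := by
      have hδ : ∀ (t : Finset ℕ) (b : ℕ → ℝ), t ⊆ Icc 1 (n - 1) →
          inn (aa n p (l + 1)) (∑ k ∈ t, b k • ω k) = if (l : ℕ) + 1 ∈ t then b (l + 1) else 0 := by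
        intro t b ht
        rw [inn_sum, ← Finset.sum_ite_eq t (l + 1 : ℕ) b]
        refine Finset.sum_congr rfl fun k hk => ?_
        have := Finset.mem_Icc.1 (ht hk)
        rw [inn_smul, hωδ _ hj'.1 hj'.2 _ this.1 this.2]
        simp
      have h1 := hδ (Icc 1 (n - p)) (fun _ => 1) (Finset.Icc_subset_Icc le_rfl (by omega))
      have h2 := hδ (Icc (n - p + 1) (n - 1)) (fun _ => 1)
        (Finset.Icc_subset_Icc (by omega) le_rfl)
      have h3 := hδ (Icc 1 (n - 1)) (fun k => m k) le_rfl
      simp only [one_smul] at h1 h2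
      rw [hx, rhoP, inn_add, inn_add, inn_smul, inn_smul, inn_smul, h1, h2, h3, if_pos hj]
      simp only [Finset.mem_Icc]
      by_cases hc : n ≤ l + p
      · rw [if_neg (by omega), if_pos (by omega), if_pos hc]
        ring
      · rw [if_pos (by omega), if_neg (by omega), if_neg hc]
        ring
    rw [inn_aa x hi] at hin
    rw [coord_fin, coord_add_p (by omega) x hi]
    have : x l - (x i - 2 * π / α * (if n ≤ l + p then 1 else 0)) - g =
        Real.sign M * m (l + 1) := by
      split_ifs at hin ⊢ <;> linarith
    rw [this, ← mul_assoc, hσ, one_mul]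
  have hlast : Real.sign M * (coord α x n - coord α x (n + p) - g) =
      |M| - ∑ j ∈ Icc 1 (n - 1), (m j : ℝ) := by
    have h1 := sum_coord_gap (α := α) (by omega : 0 < n) x p
    have h2 : Icc 1 n = insert n (Icc 1 (n - 1)) := by
      ext j
      simp only [Finset.mem_Icc, Finset.mem_insert]
      omega
    have h3 : n ∉ Icc 1 (n - 1) := by
      simp only [Finset.mem_Icc]
      omega
    have h4 : ∑ j ∈ Icc 1 n, Real.sign M * (coord α x j - coord α x (j + p) - g) = |M| := by
      rw [← Finset.mul_sum, Finset.sum_sub_distrib, h1, ← hσM, hMdef]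
      simp
      left
      ring
    rw [h2, Finset.sum_insert h3, Finset.sum_congr rfl hgap] at h4
    linarith
  refine ⟨?_, fun j hj => ?_⟩
  · have hsum : ∀ (t : Finset ℕ) (b : ℕ → ℝ), t ⊆ Icc 1 (n - 1) →
        ∑ i, (∑ k ∈ t, b k • ω k) i = 0 := by
      intro t b ht
      simp only [Finset.sum_apply, Pi.smul_apply, smul_eq_mul]
      rw [Finset.sum_comm]
      refine Finset.sum_eq_zero fun k hk => ?_
      have := Finset.mem_Icc.1 (ht hk)
      rw [← Finset.mul_sum, hωE k this.1 this.2, mul_zero]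
    have h1 := hsum (Icc 1 (n - p)) (fun _ => 1) (Finset.Icc_subset_Icc le_rfl (by omega))
    have h2 := hsum (Icc (n - p + 1) (n - 1)) (fun _ => 1)
      (Finset.Icc_subset_Icc (by omega) le_rfl)
    have h3 := hsum (Icc 1 (n - 1)) (fun k => m k) le_rfl
    simp only [one_smul] at h1 h2
    simp only [hx, rhoP, Pi.add_apply, Pi.smul_apply _ (_ : Fin n → ℝ), smul_eq_mul,
      Finset.sum_add_distrib, ← Finset.mul_sum, h1, h2, h3]
    simp
  · rcases eq_or_ne j n with rfl | hjn
    · rw [hlast]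
      linarith
    · rw [hgap j (by simp only [Finset.mem_Icc] at hj ⊢; omega)]
      positivity

lemma SigmaInt_nonempty {n p : ℕ} {α g : ℝ} (hn : 0 < n)
    (hM : 2 * π * p / α - n * g ≠ 0) : (SigmaInt n p α g).Nonempty := by
  have hn0 : (0 : ℝ) < n := by exact_mod_cast hn
  set c := (∑ i : Fin n, 2 * π / α * (i / n : ℝ)) / n with hc
  refine ⟨fun i => c - 2 * π / α * (i / n), ?_, fun j hj => ?_⟩
  · rw [Finset.sum_sub_distrib, Finset.sum_const, Finset.card_univ, Fintype.card_fin, nsmul_eq_mul,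
      hc, mul_div_cancel₀ _ hn0.ne', sub_self]
  · have hcoord : ∀ j, coord α (fun i : Fin n => c - 2 * π / α * (i / n)) (j + 1) =
        c - 2 * π / α * (j / n) := by
      intro j
      have h1 : ((j % n : ℕ) : ℝ) + n * (j / n : ℕ) = j := by exact_mod_cast Nat.mod_add_div j n
      have h2 : (j : ℝ) / n = (j % n : ℕ) / n + (j / n : ℕ) := by
        rw [div_add' _ _ _ hn0.ne', mul_comm _ (n : ℝ), h1]
      simp only [coord, hn, dif_pos, add_tsub_cancel_right]
      rw [h2]
      ring
    obtain ⟨j, rfl⟩ := Nat.exists_eq_add_of_le' (Finset.mem_Icc.1 hj).1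
    rw [add_right_comm, hcoord, hcoord]
    have : c - 2 * π / α * (j / n) - (c - 2 * π / α * ((j + p : ℕ) / n)) - g =
        (2 * π * p / α - n * g) / n := by
      push_cast
      field_simp
      ring
    rw [this, ← mul_div_assoc]
    refine div_pos ?_ hn0
    rcases hM.lt_or_gt with h | h
    · rw [Real.sign_of_neg h]; linarith
    · rw [Real.sign_of_pos h]; linarith

lemma SigmaInt_subset_SigmaBar {n p : ℕ} {α g : ℝ} : SigmaInt n p α g ⊆ SigmaBar n p α g :=
  fun _ hx => ⟨hx.1, fun j hj => (hx.2 j hj).le⟩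

lemma sign_eq_of_mul_pos {a b : ℝ} (h : 0 < a * b) : Real.sign a = Real.sign b := by
  rcases pos_and_pos_or_neg_and_neg_of_mul_pos h with ⟨ha, hb⟩ | ⟨ha, hb⟩
  · rw [Real.sign_of_pos ha, Real.sign_of_pos hb]
  · rw [Real.sign_of_neg ha, Real.sign_of_neg hb]

/-- for `μ, μ+ν ∈ Λ⁺_{p,|M|}` one has
`W_ν(ρ_p+sgn(M)μ) = W_{-ν}(ρ_p+sgn(M)(μ+ν))`, and this common value is nonzero. -/
theorem statement12 (n p q : ℕ) (α g : ℝ)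
    (hn : 2 ≤ n) (hα : 0 < α) (hp1 : 1 ≤ p) (hpn : p ≤ n - 1) (hcop : Nat.Coprime p n)
    (htype : TypeI n p q α g)
    (Mz : ℤ) (hMz : 2 * π * p / α - n * g = (Mz : ℝ)) (hMz0 : Mz ≠ 0)
    (ω : ℕ → Fin n → ℝ)
    (hωE : ∀ k : ℕ, 1 ≤ k → k ≤ n - 1 → ∑ i, ω k i = 0)
    (hωδ : ∀ j : ℕ, 1 ≤ j → j ≤ n - 1 → ∀ k : ℕ, 1 ≤ k → k ≤ n - 1 →
      inn (aa n p j) (ω k) = if j = k then (1 : ℝ) else 0)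
    (s : (Fin n → ℝ) → ℝ)
    (hs : ∀ r : ℕ, 1 ≤ r → r ≤ n - 1 → ∀ ν : Fin n → ℝ, inOrbit n r ν →
      ∀ x ∈ SigmaInt n p α g, s ν = Real.sign (Vnu n α g ν x))
    (r : ℕ) (hr1 : 1 ≤ r) (hrn : r ≤ n - 1)
    (ν : Fin n → ℝ) (hν : inOrbit n r ν)
    (μ : Fin n → ℝ) (hμ : μ ∈ Lam n |2 * π * p / α - n * g| ω)
    (hμν : μ + ν ∈ Lam n |2 * π * p / α - n * g| ω) :
    Wmu n p α g ω s μ ν = Wmu n p α g ω s (μ + ν) (-ν) ∧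
    Wmu n p α g ω s μ ν ≠ 0 := by
  set M := 2 * π * p / α - n * g with hMdef
  have hM : M ≠ 0 := by
    rw [hMz]
    exact_mod_cast hMz0
  have hσ : Real.sign M * Real.sign M = 1 := by
    rcases Real.sign_apply_eq_of_ne_zero M hM with h | h <;> rw [h] <;> norm_num
  have hmem (i : Fin n) : (i : ℕ) + 1 ∈ Icc 1 n := by
    simp [Nat.succ_le_of_lt i.2]
  obtain ⟨z, hz⟩ := SigmaInt_nonempty (by omega) hM
  have hzV := Vnu_mul_Vnu_neg_pos hn hα hp1 hpn htype hν (SigmaInt_subset_SigmaBar hz)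
    (SigmaInt_subset_SigmaBar hz) (fun _ l _ _ => hz.2 _ (hmem l)) (fun i _ _ _ => hz.2 _ (hmem i))
  have hsν := hs r hr1 hrn ν hν z hz
  have hsν' := hs (n - r) (by omega) (by omega) (-ν) (hν.neg (by omega) (by omega)) z hz
  have hss : s ν = s (-ν) := by
    rw [hsν, hsν', sign_eq_of_mul_pos hzV, ← Vnu_neg_neg α g (-ν) z, neg_neg]
  have hs0 : s ν ≠ 0 := by
    rw [hsν, Ne, Real.sign_eq_zero_iff]
    exact left_ne_zero_of_mul hzV.ne'
  have hx := rhoP_add_mem_SigmaBar hn hp1 hpn hM hωE hωδ hμ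
  have hy := rhoP_add_mem_SigmaBar hn hp1 hpn hM hωE hωδ hμν
  rw [← hMdef] at hx hy
  have hV : 0 < Vnu n α g ν (rhoP n p α g ω + Real.sign M • μ) *
      Vnu n α g ν (-(rhoP n p α g ω) - Real.sign M • (μ + ν)) := by
    rw [← neg_add']
    refine Vnu_mul_Vnu_neg_pos hn hα hp1 hpn htype hν hx hy (fun i l h1 h2 => ?_)
      (fun i l h1 h2 => ?_)
    · have h3 := hy.2 _ (hmem l)
      rw [smul_add, ← add_assoc, coord_add _ _ (by omega) h2, h1, ← hMdef] at h3
      rw [← hMdef]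
      linarith
    · have h3 := hx.2 _ (hmem i)
      rw [smul_add, ← add_assoc, coord_add _ _ (by omega) h2, ← hMdef,
        show ν l - ν i = -1 by linarith]
      rw [← hMdef] at h3
      linarith
  have hrev : Wmu n p α g ω s (μ + ν) (-ν) = s (-ν) * Real.sqrt
      (Vnu n α g ν (rhoP n p α g ω + Real.sign M • μ) *
       Vnu n α g ν (-(rhoP n p α g ω) - Real.sign M • (μ + ν))) := by
    rw [Wmu, ← hMdef, add_neg_cancel_right, if_pos hμ, ← Vnu_neg_neg α g (-ν),
      ← Vnu_neg_neg α g (-ν) (-_ - _), neg_neg, neg_sub', neg_neg, sub_neg_eq_add,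
      neg_add', mul_comm (Vnu n α g ν _)]
  have hfwd : Wmu n p α g ω s μ ν = s ν * Real.sqrt
      (Vnu n α g ν (rhoP n p α g ω + Real.sign M • μ) *
       Vnu n α g ν (-(rhoP n p α g ω) - Real.sign M • (μ + ν))) := by
    rw [Wmu, ← hMdef, if_pos hμν]
  exact ⟨by rw [hfwd, hrev, hss], by rw [hfwd]; exact mul_ne_zero hs0 (Real.sqrt_pos.2 hV).ne'⟩
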